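/- arXiv:2510.25719 — 2 statements merged into one kernel-verified Lean document; each statement's English description precedes it below -/
import Mathlib

section
/- Invariant Gaussian purification at the covariance-matrix level (Lemma 6.1(i),(ii)): Let σ be a covariance matrix of size 2n×2n (real symmetric with σ + i·Ω_n positive semidefinite as a complex matrix). Then there exists a (4n×4n) real symmetric matrix σ_ψ such that: (a) the top-left 2n×2n block of σ_ψ equals σ; (b) σ_ψ is positive definite; (c) σ_ψ * Ω_{2n} * σ_ψ * Ω_{2n} = −1 (σ_ψ is pure); and (d) for every symplectic 2n×2n matrix S with S * σ * Sᵀ = σ, the 4n×4n matrix S ⊕ (Z_n·S·Z_n) satisfies (S ⊕ Z_n·S·Z_n) * σ_ψ * (S ⊕ Z_n·S·Z_n)ᵀ = σ_ψ, where Z_n denotes the 2n×2n block-diagonal matrix with n copies of diag(1,−1) and ⊕ denotes the block-diagonal direct sum. -/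
open Matrix ComplexOrder

noncomputable section

/-- The 2×2 standard symplectic form `Ω₁ = !![0,1; -1,0]`. -/
def Omega1 : Matrix (Fin 2) (Fin 2) ℝ := !![0, 1; -1, 0]

/-- The 2n×2n standard symplectic form `Ω_n`, a block-diagonal matrix with `n` copies of `Ω₁`. -/
def OmegaN (n : ℕ) : Matrix (Fin 2 × Fin n) (Fin 2 × Fin n) ℝ :=
  Matrix.blockDiagonal fun _ => Omega1

/-- A real 2n×2n matrix is symplectic if `S * Ω_n * Sᵀ = Ω_n`. -/
def IsSymplectic {n : ℕ} (S : Matrix (Fin 2 × Fin n) (Fin 2 × Fin n) ℝ) : Prop :=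
  S * OmegaN n * Sᵀ = OmegaN n

/-- The 4n×4n symplectic form `Ω_{2n} = Ω_n ⊕ Ω_n` on the doubled system. -/
def OmegaDouble (n : ℕ) :
    Matrix ((Fin 2 × Fin n) ⊕ (Fin 2 × Fin n)) ((Fin 2 × Fin n) ⊕ (Fin 2 × Fin n)) ℝ :=
  Matrix.fromBlocks (OmegaN n) 0 0 (OmegaN n)

/-- The 2n×2n time-reversal matrix `Z_n`, block diagonal with `n` copies of `diag(1,−1)`. -/
def Zn (n : ℕ) : Matrix (Fin 2 × Fin n) (Fin 2 × Fin n) ℝ :=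
  Matrix.blockDiagonal fun _ => !![(1 : ℝ), 0; 0, -1]

section PurificationHelpers

open scoped MatrixOrder

lemma psd_sqrt_exists {m : Type*} [Fintype m] [DecidableEq m] (A : Matrix m m ℝ)
    (hA : A.PosSemidef) :
    ∃ R : Matrix m m ℝ, Rᵀ = R ∧ R * R = A ∧ ∀ O : Matrix m m ℝ, A * O = O * A → R * O = O * R := by
  have h0 : 0 ≤ A := hA.nonneg
  refine ⟨CFC.sqrt A, ?_, CFC.sqrt_mul_sqrt_self A h0, ?_⟩
  · have := (CFC.sqrt_nonneg A).posSemidef.1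
    simpa [Matrix.IsHermitian, Matrix.conjTranspose_eq_transpose_of_trivial] using this
  · intro O hO
    have h2 : Commute A O := hO
    rw [CFC.sqrt_eq_real_sqrt A h0]
    have hsa : IsSelfAdjoint A := hA.1
    have h3 : Commute (cfcₙ Real.sqrt A) O := IsSelfAdjoint.commute_cfcₙ hsa h2 _
    exact h3.eq

lemma quad_ofReal {m : Type*} [Fintype m] (A : Matrix m m ℝ) (x : m → ℝ) :
    star (fun i => (x i : ℂ)) ⬝ᵥ (A.map (Complex.ofReal : ℝ → ℂ)) *ᵥ (fun i => (x i : ℂ))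
      = ((x ⬝ᵥ A *ᵥ x : ℝ) : ℂ) := by
  simp [dotProduct, mulVec, Matrix.map_apply]

lemma psd_of_map {m : Type*} [Fintype m] (A : Matrix m m ℝ) (hs : Aᵀ = A)
    (h : (A.map (Complex.ofReal : ℝ → ℂ)).PosSemidef) : A.PosSemidef := by
  refine .of_dotProduct_mulVec_nonneg ?_ fun x => ?_
  · simpa [Matrix.IsHermitian, Matrix.conjTranspose_eq_transpose_of_trivial] using hs
  · have := h.dotProduct_mulVec_nonneg (fun i => (x i : ℂ))
    rw [quad_ofReal] at this
    simpa using this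

lemma antisymm_quad {m : Type*} [Fintype m] (W : Matrix m m ℝ) (hW : Wᵀ = -W) (x : m → ℝ) :
    x ⬝ᵥ W *ᵥ x = 0 := by
  have h : x ⬝ᵥ W *ᵥ x = x ⬝ᵥ Wᵀ *ᵥ x := by
    rw [mulVec_transpose, dotProduct_mulVec, dotProduct_comm]
  rw [hW, neg_mulVec, dotProduct_neg] at h
  linarith

lemma cov_posDef {m : Type*} [Fintype m] [DecidableEq m] (σ W : Matrix m m ℝ)
    (hs : σᵀ = σ) (hW : Wᵀ = -W) (hWW : W * W = -1)
    (h : (σ.map (Complex.ofReal : ℝ → ℂ) +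
        Complex.I • W.map (Complex.ofReal : ℝ → ℂ)).PosSemidef) : σ.PosDef := by
  refine .of_dotProduct_mulVec_pos ?_ fun x hx => ?_
  · simpa [Matrix.IsHermitian, Matrix.conjTranspose_eq_transpose_of_trivial] using hs
  have key : star (fun i => (x i : ℂ)) ⬝ᵥ (σ.map (Complex.ofReal : ℝ → ℂ) +
        Complex.I • W.map (Complex.ofReal : ℝ → ℂ)) *ᵥ (fun i => (x i : ℂ))
        = ((x ⬝ᵥ σ *ᵥ x : ℝ) : ℂ) := by
    rw [add_mulVec, smul_mulVec, dotProduct_add, dotProduct_smul, quad_ofReal, quad_ofReal,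
      antisymm_quad W hW]
    simp
  have h1 := h.dotProduct_mulVec_nonneg (fun i => (x i : ℂ))
  rw [key] at h1
  have h2 : 0 ≤ x ⬝ᵥ σ *ᵥ x := by simpa using h1
  have h3 : x ⬝ᵥ σ *ᵥ x ≠ 0 := by
    intro h0
    rw [h0] at key
    have h4 := (h.dotProduct_mulVec_zero_iff _).1 (by simpa using key)
    have h5 : W *ᵥ x = 0 := by
      funext i
      have h6 := congrArg Complex.im (congrFun h4 i)
      simpa [mulVec, dotProduct, Matrix.map_apply, add_mul, mul_assoc] using h6
    apply hx
    have h7 : (W * W) *ᵥ x = 0 := by rw [← mulVec_mulVec, h5, mulVec_zero]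
    rw [hWW, neg_mulVec, one_mulVec] at h7
    simpa using h7
  have h8 : 0 < x ⬝ᵥ σ *ᵥ x := lt_of_le_of_ne h2 (Ne.symm h3)
  simpa using h8

lemma cov_schur {m : Type*} [Fintype m] [DecidableEq m] (σ s W : Matrix m m ℝ)
    (hs : σᵀ = σ) (hst : sᵀ = s) (hW : Wᵀ = -W) (h1 : σ * s = 1) (h2 : s * σ = 1)
    (hspd : s.PosDef)
    (h : (σ.map (Complex.ofReal : ℝ → ℂ) +
        Complex.I • W.map (Complex.ofReal : ℝ → ℂ)).PosSemidef) :
    (σ + W * s * W).PosSemidef := by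
  apply psd_of_map
  · simp [hs, hst, hW, Matrix.mul_assoc]
  have hmap : ∀ A B : Matrix m m ℝ, (A * B).map (Complex.ofReal : ℝ → ℂ)
      = A.map (Complex.ofReal : ℝ → ℂ) * B.map (Complex.ofReal : ℝ → ℂ) := fun A B =>
    Matrix.map_mul (f := Complex.ofRealHom)
  have hone : (1 : Matrix m m ℝ).map (Complex.ofReal : ℝ → ℂ) = 1 :=
    Matrix.map_one _ Complex.ofReal_zero Complex.ofReal_one
  have hadd : (σ + W * s * W).map (Complex.ofReal : ℝ → ℂ)
      = σ.map (Complex.ofReal : ℝ → ℂ) + (W.map (Complex.ofReal : ℝ → ℂ)) *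
        (s.map (Complex.ofReal : ℝ → ℂ)) * (W.map (Complex.ofReal : ℝ → ℂ)) := by
    rw [Matrix.map_add _ Complex.ofReal_add, hmap, hmap]
  rw [hadd]
  have c1 : σ.map (Complex.ofReal : ℝ → ℂ) * s.map (Complex.ofReal : ℝ → ℂ) = 1 := by
    rw [← hmap, h1, hone]
  have c2 : s.map (Complex.ofReal : ℝ → ℂ) * σ.map (Complex.ofReal : ℝ → ℂ) = 1 := by
    rw [← hmap, h2, hone]
  have hTs : (σ.map (Complex.ofReal : ℝ → ℂ))ᵀ = σ.map (Complex.ofReal : ℝ → ℂ) := by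
    rw [← Matrix.transpose_map, hs]
  have hTW : (W.map (Complex.ofReal : ℝ → ℂ))ᵀ = -W.map (Complex.ofReal : ℝ → ℂ) := by
    rw [← Matrix.transpose_map, hW]; ext; simp
  have hsH : (s.map (Complex.ofReal : ℝ → ℂ))ᴴ = s.map (Complex.ofReal : ℝ → ℂ) := by
    ext i j
    have := congrFun (congrFun hst i) j
    simp [Matrix.conjTranspose_apply] at this ⊢
    exact this
  have hp2 := h.transpose
  rw [transpose_add, transpose_smul, hTs, hTW] at hp2
  generalize σ.map (Complex.ofReal : ℝ → ℂ) = σc at *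
  generalize s.map (Complex.ofReal : ℝ → ℂ) = sc at *
  generalize W.map (Complex.ofReal : ℝ → ℂ) = Wc at *
  have e1 := hp2.conjTranspose_mul_mul_same (sc * (σc + Complex.I • Wc))
  have e2 := h.conjTranspose_mul_mul_same (sc * (σc + Complex.I • -Wc))
  rw [conjTranspose_mul, hsH, h.1.eq] at e1
  rw [conjTranspose_mul, hsH, hp2.1.eq] at e2
  have r1 : ∀ X, σc * (sc * X) = X := fun X => by rw [← Matrix.mul_assoc, c1, Matrix.one_mul]
  have r2 : ∀ X, sc * (σc * X) = X := fun X => by rw [← Matrix.mul_assoc, c2, Matrix.one_mul]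
  have hI : ∀ X : Matrix m m ℂ, Complex.I • Complex.I • X = -X := fun X => by
    rw [smul_smul, Complex.I_mul_I, neg_one_smul]
  have e3 := (e1.add e2).smul (a := (1/2 : ℂ)) (by norm_num [Complex.le_def])
  refine (congrArg Matrix.PosSemidef ?_).mpr e3
  simp only [Matrix.mul_assoc, Matrix.add_mul, Matrix.mul_add, Matrix.smul_mul, Matrix.mul_smul,
    r1, r2, c1, c2, Matrix.neg_mul, Matrix.mul_neg, smul_neg, hI, neg_neg, smul_add,
    Matrix.mul_one, Matrix.one_mul]
  module

/-- The algebraic core: existence of the off-diagonal correlation block. -/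
lemma exists_Y {m : Type*} [Fintype m] [DecidableEq m] (σ s W : Matrix m m ℝ)
    (hσ : σ.PosDef) (hW : Wᵀ = -W) (hWW : W * W = -1) (h1 : σ * s = 1)
    (hE : (σ + W * s * W).PosSemidef) :
    ∃ Y : Matrix m m ℝ, Yᵀ = -Y ∧ Y * W * Y * W = -1 - σ * W * σ * W ∧
      σ * W * Y = Y * W * σ ∧
      ∀ S : Matrix m m ℝ, S * W * Sᵀ = W → S * σ * Sᵀ = σ → S * Y * Sᵀ = Y := by
  obtain ⟨B, hBt, hBB, -⟩ := psd_sqrt_exists σ hσ.posSemidef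
  have hBC : B * (B * s) = 1 := by rw [← Matrix.mul_assoc, hBB, h1]
  obtain ⟨C, hC⟩ : ∃ C, C = B * s := ⟨_, rfl⟩
  rw [← hC] at hBC
  have hCB : C * B = 1 := mul_eq_one_comm.1 hBC
  have hCt : Cᵀ = C := by
    have : Cᵀ * B = 1 := by rw [← hBt, ← transpose_mul, hBC, transpose_one]
    calc Cᵀ = Cᵀ * (B * C) := by rw [hBC, Matrix.mul_one]
      _ = C := by rw [← Matrix.mul_assoc, this, Matrix.one_mul]
  have hs : s = C * C := by
    rw [hC]
    calc s = (C * B) * s := by rw [hCB, Matrix.one_mul]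
      _ = _ := by rw [hC]; simp only [Matrix.mul_assoc]
  have rBC : ∀ X, B * (C * X) = X := fun X => by rw [← Matrix.mul_assoc, hBC, Matrix.one_mul]
  have rCB : ∀ X, C * (B * X) = X := fun X => by rw [← Matrix.mul_assoc, hCB, Matrix.one_mul]
  have rWW : ∀ X, W * (W * X) = -X := fun X => by rw [← Matrix.mul_assoc, hWW]; simp
  have hQ : (-(B * W * B * (B * W * B)) - 1).PosSemidef := by
    have := hE.mul_mul_conjTranspose_same (B * W)
    rw [conjTranspose_eq_transpose_of_trivial, transpose_mul, hW, hBt] at this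
    convert this using 1
    rw [hs, ← hBB]
    simp only [Matrix.mul_assoc, Matrix.mul_add, Matrix.add_mul, Matrix.mul_neg, Matrix.neg_mul,
      rWW, rBC, hCB, neg_neg]
    abel
  obtain ⟨R, hRt, hRR, hRc⟩ := psd_sqrt_exists _ hQ
  have hRK : R * (B * W * B) = (B * W * B) * R := by
    apply hRc
    simp only [Matrix.sub_mul, Matrix.mul_sub, Matrix.neg_mul, Matrix.mul_neg, Matrix.mul_assoc,
      Matrix.one_mul, Matrix.mul_one]
  have hRG : R * (C * W * C) = (C * W * C) * R := by
    have a := congrArg (fun X => (C * W * C) * X * (C * W * C)) hRK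
    simp only [Matrix.mul_assoc, rCB, rBC, rWW, Matrix.mul_neg] at a
    simp only [hBC, hWW, Matrix.mul_one, Matrix.mul_neg, neg_inj, Matrix.mul_assoc, rWW, rCB, rBC]
      at a
    have a2 := congrArg (fun X => -X) a.symm
    simpa only [Matrix.mul_assoc, Matrix.neg_mul, neg_neg] using a2
  refine ⟨-(B * R * C * W), ?_, ?_, ?_, ?_⟩
  · have a := congrArg (fun X => B * X * B) hRG
    simp only [Matrix.mul_assoc, rBC, hCB, Matrix.mul_one] at a
    simp only [transpose_neg, transpose_mul, hW, hCt, hRt, hBt, Matrix.neg_mul, Matrix.mul_neg,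
      neg_neg, Matrix.mul_assoc, a]
  · have a : B * (R * R) * C = -(B * (B * W * B * (B * W * B)) * C) - 1 := by
      rw [hRR]
      simp [Matrix.mul_sub, Matrix.sub_mul, hBC]
    rw [← hBB]
    simp only [Matrix.mul_assoc, hBC, Matrix.mul_one] at a
    simp only [Matrix.mul_assoc, Matrix.neg_mul, Matrix.mul_neg, rWW, hWW, rCB, neg_neg,
      Matrix.mul_one, a]
    abel
  · have a := congrArg (fun X => B * X * C * W) hRK
    simp only [Matrix.mul_assoc, rBC, hWW, Matrix.mul_neg, Matrix.mul_one] at a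
    rw [← hBB]
    simp only [Matrix.mul_assoc, Matrix.neg_mul, Matrix.mul_neg, rWW, rCB, neg_neg, ← a]
  · intro S hSW hSσ
    have hSW' : Sᵀ * W * S = W := by
      have b : S * (-(W * Sᵀ * W)) = 1 := by
        rw [Matrix.mul_neg, ← Matrix.mul_assoc, ← Matrix.mul_assoc, hSW, hWW, neg_neg]
      have b' := mul_eq_one_comm.1 b
      have := congrArg (fun X => W * X) b'
      simpa only [Matrix.mul_assoc, Matrix.neg_mul, Matrix.mul_neg, rWW, neg_neg,
        Matrix.mul_one] using this
    have hcom : S * (σ * W) = (σ * W) * S := by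
      calc S * (σ * W) = S * (σ * (Sᵀ * W * S)) := by rw [hSW']
        _ = (S * σ * Sᵀ) * W * S := by simp only [Matrix.mul_assoc]
        _ = _ := by rw [hSσ]
    have hcom2 : σ * W * (σ * W) * S = S * (σ * W * (σ * W)) := by
      rw [Matrix.mul_assoc, ← hcom, ← Matrix.mul_assoc, ← hcom, Matrix.mul_assoc]
    have hO : R * (C * S * B) = (C * S * B) * R := by
      apply hRc
      have a := congrArg (fun X => C * X * B) hcom2
      simp only [← hBB, Matrix.mul_assoc, rCB] at a
      simp only [Matrix.sub_mul, Matrix.mul_sub, Matrix.neg_mul, Matrix.mul_neg, Matrix.mul_assoc,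
        Matrix.one_mul, Matrix.mul_one, rBC, a]
    have hSN : S * (B * R * C) = B * R * C * S := by
      have a := congrArg (fun X => B * X * C) hO
      simp only [Matrix.mul_assoc, rBC, hBC, Matrix.mul_one] at a
      simp only [Matrix.mul_assoc, a]
    calc S * -(B * R * C * W) * Sᵀ = -((S * (B * R * C)) * W * Sᵀ) := by
          simp only [Matrix.mul_assoc, Matrix.neg_mul, Matrix.mul_neg]
      _ = -((B * R * C) * (S * W * Sᵀ)) := by rw [hSN]; simp only [Matrix.mul_assoc]
      _ = _ := by rw [hSW]

lemma purification_general {m : Type*} [Fintype m] [DecidableEq m] (σ W Z : Matrix m m ℝ)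
    (hs : σᵀ = σ) (hW : Wᵀ = -W) (hWW : W * W = -1) (hZ : Zᵀ = Z) (hZZ : Z * Z = 1)
    (hZW : Z * W = -(W * Z))
    (h : (σ.map (Complex.ofReal : ℝ → ℂ) +
        Complex.I • W.map (Complex.ofReal : ℝ → ℂ)).PosSemidef) :
    ∃ P : Matrix (m ⊕ m) (m ⊕ m) ℝ, Pᵀ = P ∧ P.toBlocks₁₁ = σ ∧ P.PosDef ∧
      P * fromBlocks W 0 0 W * P * fromBlocks W 0 0 W = -1 ∧
      ∀ S : Matrix m m ℝ, S * W * Sᵀ = W → S * σ * Sᵀ = σ →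
        fromBlocks S 0 0 (Z * S * Z) * P * (fromBlocks S 0 0 (Z * S * Z))ᵀ = P := by
  have hσ := cov_posDef σ W hs hW hWW h
  have hdet : IsUnit σ.det := (Matrix.isUnit_iff_isUnit_det σ).1 hσ.isUnit
  have h1 : σ * σ⁻¹ = 1 := Matrix.mul_nonsing_inv σ hdet
  have h2 : σ⁻¹ * σ = 1 := Matrix.nonsing_inv_mul σ hdet
  have hst : (σ⁻¹)ᵀ = σ⁻¹ := by rw [Matrix.transpose_nonsing_inv, hs]
  have hE := cov_schur σ σ⁻¹ W hs hst hW h1 h2 hσ.inv h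
  obtain ⟨Y, hYt, hY1, hY2, hYS⟩ := exists_Y σ σ⁻¹ W hσ hW hWW h1 hE
  have rWW : ∀ X, W * (W * X) = -X := fun X => by rw [← Matrix.mul_assoc, hWW]; simp
  have rZZ : ∀ X, Z * (Z * X) = X := fun X => by rw [← Matrix.mul_assoc, hZZ, Matrix.one_mul]
  have rZW : ∀ X, Z * (W * X) = -(W * (Z * X)) := fun X => by
    rw [← Matrix.mul_assoc, hZW, Matrix.neg_mul, Matrix.mul_assoc]
  have r1 : ∀ X, σ * (σ⁻¹ * X) = X := fun X => by rw [← Matrix.mul_assoc, h1, Matrix.one_mul]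
  have r2 : ∀ X, σ⁻¹ * (σ * X) = X := fun X => by rw [← Matrix.mul_assoc, h2, Matrix.one_mul]
  have hsym : (fromBlocks σ (Y * Z) (Y * Z)ᵀ (Z * σ * Z))ᵀ
      = fromBlocks σ (Y * Z) (Y * Z)ᵀ (Z * σ * Z) := by
    rw [fromBlocks_transpose, transpose_transpose, hs]
    simp only [transpose_mul, hs, hZ, Matrix.mul_assoc]
  have hYZ : (Y * Z)ᵀ = -(Z * Y) := by rw [transpose_mul, hZ, hYt, Matrix.mul_neg]
  have hpure : fromBlocks σ (Y * Z) (Y * Z)ᵀ (Z * σ * Z) * fromBlocks W 0 0 W *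
      fromBlocks σ (Y * Z) (Y * Z)ᵀ (Z * σ * Z) * fromBlocks W 0 0 W = -1 := by
    have hY1' : Y * (W * (Y * W)) = -1 - σ * (W * (σ * W)) := by
      simpa only [Matrix.mul_assoc] using hY1
    have hY2' : σ * (W * Y) = Y * (W * σ) := by simpa only [Matrix.mul_assoc] using hY2
    have hY1'' : ∀ X, Y * (W * (Y * (W * X))) = -X - σ * (W * (σ * (W * X))) := fun X => by
      have := congrArg (· * X) hY1'
      simpa only [Matrix.mul_assoc, Matrix.sub_mul, Matrix.neg_mul, Matrix.one_mul] using this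
    have hY2'' : ∀ X, σ * (W * (Y * X)) = Y * (W * (σ * X)) := fun X => by
      have := congrArg (· * X) hY2'
      simpa only [Matrix.mul_assoc] using this
    rw [hYZ]
    simp only [fromBlocks_multiply, Matrix.mul_zero, Matrix.zero_mul, add_zero, zero_add]
    rw [← fromBlocks_one, fromBlocks_neg]
    congr 1 <;> simp only [Matrix.mul_assoc, Matrix.neg_mul, Matrix.mul_neg, rZW, rZZ, hZW,
      Matrix.add_mul, Matrix.mul_add, neg_neg, hY1', hY2', hY1'', hY2'', Matrix.mul_sub, hZZ] <;>
      simp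
  refine ⟨fromBlocks σ (Y * Z) (Y * Z)ᵀ (Z * σ * Z), hsym, toBlocks_fromBlocks₁₁ .., ?_, hpure, ?_⟩
  · have hunit : IsUnit (fromBlocks σ (Y * Z) (Y * Z)ᵀ (Z * σ * Z)) := by
      refine IsUnit.of_mul_eq_one (-(fromBlocks W 0 0 W *
        fromBlocks σ (Y * Z) (Y * Z)ᵀ (Z * σ * Z) * fromBlocks W 0 0 W)) ?_
      rw [Matrix.mul_neg, ← Matrix.mul_assoc, ← Matrix.mul_assoc, hpure, neg_neg]
    have hpsd : (fromBlocks σ (Y * Z) (Y * Z)ᵀ (Z * σ * Z)).PosSemidef := by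
      have hinv : Invertible σ := hσ.isUnit.invertible
      have := PosDef.fromBlocks₁₁ (Y * Z) (Z * σ * Z) hσ
      rw [conjTranspose_eq_transpose_of_trivial] at this
      rw [this]
      have e := hσ.inv.posSemidef.conjTranspose_mul_mul_same (W * Z)
      refine (congrArg Matrix.PosSemidef ?_).mpr e
      have a : σ⁻¹ * Y * W = W * Y * σ⁻¹ := by
        have := congrArg (fun X => σ⁻¹ * X * σ⁻¹) hY2
        simp only [Matrix.mul_assoc, r2, h1, Matrix.mul_one] at this
        simpa only [Matrix.mul_assoc] using this.symm
      have b : Y * σ⁻¹ * Y = -(W * σ⁻¹ * W) - σ := by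
        calc Y * σ⁻¹ * Y = -(W * (W * Y * σ⁻¹) * Y) := by
              simp only [Matrix.mul_assoc, rWW, Matrix.neg_mul, neg_neg]
          _ = W * (σ⁻¹ * (Y * W * Y * W) * W) := by
              rw [← a]; simp only [Matrix.mul_assoc, hWW, Matrix.mul_neg, Matrix.mul_one]
          _ = _ := by
              rw [hY1]
              simp only [Matrix.mul_assoc, Matrix.mul_sub, Matrix.sub_mul, hWW, Matrix.mul_neg,
                Matrix.neg_mul, Matrix.mul_one, Matrix.one_mul, r2, rWW]
              abel
      have c := congrArg (fun X => Z * X * Z) b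
      simp only [Matrix.mul_assoc, Matrix.mul_sub, Matrix.sub_mul, Matrix.mul_neg,
        Matrix.neg_mul] at c
      rw [hYZ, conjTranspose_eq_transpose_of_trivial, transpose_mul, hW, hZ]
      simp only [Matrix.mul_assoc, Matrix.mul_neg, Matrix.neg_mul, c]
      abel
    exact hpsd.posDef_iff_isUnit.2 hunit
  · intro S hSW hSσ
    have y := hYS S hSW hSσ
    have y' : ∀ X, S * (Y * (Sᵀ * X)) = Y * X := fun X => by
      have := congrArg (· * X) y
      simpa only [Matrix.mul_assoc] using this
    have s' : ∀ X, S * (σ * (Sᵀ * X)) = σ * X := fun X => by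
      have := congrArg (· * X) hSσ
      simpa only [Matrix.mul_assoc] using this
    have y0 : S * (Y * Sᵀ) = Y := by rw [← Matrix.mul_assoc, y]
    have s0 : S * (σ * Sᵀ) = σ := by rw [← Matrix.mul_assoc, hSσ]
    rw [hYZ]
    simp only [fromBlocks_transpose, fromBlocks_multiply, Matrix.mul_zero, Matrix.zero_mul,
      add_zero, zero_add, transpose_zero, transpose_mul, hZ, Matrix.mul_assoc, Matrix.mul_neg,
      Matrix.neg_mul, rZZ, y', s', y0, s0, neg_zero]

lemma OmegaN_transpose (n : ℕ) : (OmegaN n)ᵀ = -OmegaN n := by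
  rw [OmegaN, blockDiagonal_transpose, ← blockDiagonal_neg]
  congr 1
  funext _
  ext i j
  fin_cases i <;> fin_cases j <;> simp [Omega1]

lemma OmegaN_sq (n : ℕ) : OmegaN n * OmegaN n = -1 := by
  rw [OmegaN, ← blockDiagonal_mul, ← blockDiagonal_one, ← blockDiagonal_neg]
  congr 1
  funext _
  ext i j
  fin_cases i <;> fin_cases j <;> simp [Omega1]

lemma Zn_transpose (n : ℕ) : (Zn n)ᵀ = Zn n := by
  rw [Zn, blockDiagonal_transpose]
  congr 1
  funext _
  ext i j
  fin_cases i <;> fin_cases j <;> simp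

lemma Zn_sq (n : ℕ) : Zn n * Zn n = 1 := by
  rw [Zn, ← blockDiagonal_mul, ← blockDiagonal_one]
  congr 1
  funext _
  ext i j
  fin_cases i <;> fin_cases j <;> simp

lemma Zn_OmegaN (n : ℕ) : Zn n * OmegaN n = -(OmegaN n * Zn n) := by
  rw [Zn, OmegaN, ← blockDiagonal_mul, ← blockDiagonal_mul, ← blockDiagonal_neg]
  congr 1
  funext _
  ext i j
  fin_cases i <;> fin_cases j <;> simp [Omega1]

end PurificationHelpers

/-- Invariant Gaussian purification at the covariance-matrix level (Lemma 6.1(i),(ii)):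
any covariance matrix `σ` admits a pure positive-definite symmetric extension `σ_ψ`
with top-left block `σ`, invariant under `S ⊕ (Z_n S Z_n)` for every symplectic `S`
preserving `σ`. -/
theorem invariant_gaussian_purification (n : ℕ)
    (σ : Matrix (Fin 2 × Fin n) (Fin 2 × Fin n) ℝ)
    (hσsymm : σ.IsSymm)
    (hσunc : (σ.map (Complex.ofReal : ℝ → ℂ) +
        Complex.I • (OmegaN n).map (Complex.ofReal : ℝ → ℂ)).PosSemidef) :
    ∃ σψ : Matrix ((Fin 2 × Fin n) ⊕ (Fin 2 × Fin n)) ((Fin 2 × Fin n) ⊕ (Fin 2 × Fin n)) ℝ,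
      σψ.IsSymm ∧
      σψ.toBlocks₁₁ = σ ∧
      σψ.PosDef ∧
      σψ * OmegaDouble n * σψ * OmegaDouble n = -1 ∧
      ∀ S : Matrix (Fin 2 × Fin n) (Fin 2 × Fin n) ℝ, IsSymplectic S → S * σ * Sᵀ = σ →
        (Matrix.fromBlocks S 0 0 (Zn n * S * Zn n)) * σψ *
          (Matrix.fromBlocks S 0 0 (Zn n * S * Zn n))ᵀ = σψ := by
  exact purification_general σ (OmegaN n) (Zn n) hσsymm (OmegaN_transpose n) (OmegaN_sq n)
    (Zn_transpose n) (Zn_sq n) (Zn_OmegaN n) hσunc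
end
end

section
/- Commutant of the realified defining representation of SU(2) (Appendix C.4, Eq. (45)): For U in the special unitary group SU(2) of 2×2 complex matrices, let ρ(U) denote the 4×4 real matrix whose 2×2 block at position (j,k) is !![Re U_{jk}, −Im U_{jk}; Im U_{jk}, Re U_{jk}]. Let Ω₂ denote the 4×4 block-diagonal matrix with two copies of Ω₁ = !![0,1; -1,0], and let X₋ be the 4×4 matrix !![0,0,1,0; 0,0,0,−1; −1,0,0,0; 0,1,0,0]. Then: (a) a 4×4 real matrix X satisfies X * ρ(U) = ρ(U) * X for all U ∈ SU(2) if and only if X lies in the real linear span of {1, Ω₂, X₋, Ω₂·X₋}; and (b) a 4×4 real symmetric matrix Y satisfies ρ(U) * Y * ρ(U)ᵀ = Y for all U ∈ SU(2) if and only if Y = y • 1 for some real y. -/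
open Matrix

noncomputable section

/-- The realification of a 2×2 complex matrix: the 4×4 real matrix whose 2×2 block at mode
position `(j,k)` is `!![Re U_{jk}, −Im U_{jk}; Im U_{jk}, Re U_{jk}]`. -/
def realify (U : Matrix (Fin 2) (Fin 2) ℂ) : Matrix (Fin 2 × Fin 2) (Fin 2 × Fin 2) ℝ :=
  Matrix.of fun p q =>
    !![(U p.2 q.2).re, -(U p.2 q.2).im; (U p.2 q.2).im, (U p.2 q.2).re] p.1 q.1

/-- The 2×2 Pauli-Z matrix. -/
def Zmat : Matrix (Fin 2) (Fin 2) ℝ := !![1, 0; 0, -1]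

/-- The matrix `X₋`, given in the basis `(x₁,p₁,x₂,p₂)` by
`!![0,0,1,0; 0,0,0,−1; −1,0,0,0; 0,1,0,0]`: its block at mode position `(1,2)` is `Z` and at
mode position `(2,1)` is `−Z`. -/
def Xminus : Matrix (Fin 2 × Fin 2) (Fin 2 × Fin 2) ℝ :=
  Matrix.of fun p q =>
    if p.2 = 0 ∧ q.2 = 1 then Zmat p.1 q.1
    else if p.2 = 1 ∧ q.2 = 0 then -Zmat p.1 q.1
    else 0


/-- Entries of a special unitary 2×2 matrix. -/
lemma su2_entries (U : Matrix.specialUnitaryGroup (Fin 2) ℂ) :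
    U.1 1 1 = star (U.1 0 0) ∧ U.1 1 0 = - star (U.1 0 1) ∧
      (U.1 0 0).re ^ 2 + (U.1 0 0).im ^ 2 + (U.1 0 1).re ^ 2 + (U.1 0 1).im ^ 2 = 1 := by
  obtain ⟨U, hU⟩ := U
  rw [Matrix.mem_specialUnitaryGroup_iff] at hU
  obtain ⟨h1, h2⟩ := hU
  have h3 : U * star U = 1 := (Matrix.mem_unitaryGroup_iff).1 h1
  have h4 : U.adjugate * U = 1 := by rw [Matrix.adjugate_mul, h2, one_smul]
  have h5 : U.adjugate = star U := left_inv_eq_right_inv h4 h3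
  rw [Matrix.adjugate_fin_two] at h5
  have e1 : U 1 1 = star (U 0 0) := by
    simpa [Matrix.star_apply] using congrFun (congrFun h5 0) 0
  have e2 : - U 1 0 = star (U 0 1) := by
    simpa [Matrix.star_apply] using congrFun (congrFun h5 1) 0
  have e3 : U 1 0 = - star (U 0 1) := by rw [← e2, neg_neg]
  refine ⟨e1, e3, ?_⟩
  rw [Matrix.det_fin_two, e1, e3] at h2
  have := congrArg Complex.re h2
  simp at this
  linarith

/-- The element `diag(i, -i)` of SU(2). -/
def suI : Matrix.specialUnitaryGroup (Fin 2) ℂ :=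
  ⟨!![Complex.I, 0; 0, -Complex.I], by
    rw [Matrix.mem_specialUnitaryGroup_iff, Matrix.mem_unitaryGroup_iff]
    constructor
    · ext i j
      fin_cases i <;> fin_cases j <;> simp [Matrix.mul_apply, Matrix.star_apply]
    · simp [Matrix.det_fin_two]⟩

/-- The element `!![0, 1; -1, 0]` of SU(2). -/
def suJ : Matrix.specialUnitaryGroup (Fin 2) ℂ :=
  ⟨!![0, 1; -1, 0], by
    rw [Matrix.mem_specialUnitaryGroup_iff, Matrix.mem_unitaryGroup_iff]
    constructor
    · ext i j
      fin_cases i <;> fin_cases j <;> simp [Matrix.mul_apply, Matrix.star_apply]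
    · simp [Matrix.det_fin_two]⟩

lemma realify_orth (U : Matrix.specialUnitaryGroup (Fin 2) ℂ) :
    realify U.1 * (realify U.1)ᵀ = 1 := by
  obtain ⟨h1, h2, h3⟩ := su2_entries U
  ext ⟨a, b⟩ ⟨c, d⟩
  fin_cases a <;> fin_cases b <;> fin_cases c <;> fin_cases d <;>
    simp [Matrix.mul_apply, Fintype.sum_prod_type, realify, h1, h2, Matrix.one_apply] <;>
    linarith

lemma realify_orth_left (U : Matrix.specialUnitaryGroup (Fin 2) ℂ) :
    (realify U.1)ᵀ * realify U.1 = 1 :=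
  mul_eq_one_comm.1 (realify_orth U)

lemma omega_comm (U : Matrix (Fin 2) (Fin 2) ℂ) :
    OmegaN 2 * realify U = realify U * OmegaN 2 := by
  ext ⟨a, b⟩ ⟨c, d⟩
  fin_cases a <;> fin_cases b <;> fin_cases c <;> fin_cases d <;>
    simp [Matrix.mul_apply, Fintype.sum_prod_type, realify, OmegaN, Omega1,
      Matrix.blockDiagonal_apply]

lemma xminus_comm (U : Matrix.specialUnitaryGroup (Fin 2) ℂ) :
    Xminus * realify U.1 = realify U.1 * Xminus := by
  obtain ⟨h1, h2, h3⟩ := su2_entries U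
  ext ⟨a, b⟩ ⟨c, d⟩
  fin_cases a <;> fin_cases b <;> fin_cases c <;> fin_cases d <;>
    simp [Matrix.mul_apply, Fintype.sum_prod_type, realify, Xminus, Zmat, h1, h2]

/-- A matrix commuting with two generators of the quaternion group is an explicit combination. -/
lemma comm_form (X : Matrix (Fin 2 × Fin 2) (Fin 2 × Fin 2) ℝ)
    (hI : X * realify suI.1 = realify suI.1 * X) (hJ : X * realify suJ.1 = realify suJ.1 * X) :
    X = X (0, 0) (0, 0) • (1 : Matrix (Fin 2 × Fin 2) (Fin 2 × Fin 2) ℝ)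
      + X (0, 0) (1, 0) • OmegaN 2 + X (0, 0) (0, 1) • Xminus
      + (- X (0, 0) (1, 1)) • (OmegaN 2 * Xminus) := by
  have hI' := fun a b c d => congrFun (congrFun hI (a, b)) (c, d)
  have hJ' := fun a b c d => congrFun (congrFun hJ (a, b)) (c, d)
  simp only [Fin.forall_fin_two] at hI' hJ'
  simp [Matrix.mul_apply, Fintype.sum_prod_type, realify, suI] at hI'
  simp [Matrix.mul_apply, Fintype.sum_prod_type, realify, suJ] at hJ'
  ext ⟨a, b⟩ ⟨c, d⟩
  fin_cases a <;> fin_cases b <;> fin_cases c <;> fin_cases d <;>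
    simp [Matrix.mul_apply, Fintype.sum_prod_type, OmegaN, Omega1, Xminus, Zmat,
      Matrix.blockDiagonal_apply, Matrix.one_apply] <;>
    grind

/-- Commutant of the realified defining representation of SU(2) (Appendix C.4, Eq. (45)):
(a) a real 4×4 matrix commutes with `ρ(U)` for all `U ∈ SU(2)` iff it lies in the real span
of `{1, Ω₂, X₋, Ω₂ X₋}`; (b) a real symmetric 4×4 matrix is invariant by congruence under
all `ρ(U)` iff it is a real multiple of the identity. -/
theorem su2_realified_commutant
    (X Y : Matrix (Fin 2 × Fin 2) (Fin 2 × Fin 2) ℝ) (hY : Y.IsSymm) :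
    ((∀ U : Matrix.specialUnitaryGroup (Fin 2) ℂ,
        X * realify (U : Matrix (Fin 2) (Fin 2) ℂ) = realify (U : Matrix (Fin 2) (Fin 2) ℂ) * X) ↔
      X ∈ Submodule.span ℝ
        ({1, OmegaN 2, Xminus, OmegaN 2 * Xminus} :
          Set (Matrix (Fin 2 × Fin 2) (Fin 2 × Fin 2) ℝ))) ∧
    ((∀ U : Matrix.specialUnitaryGroup (Fin 2) ℂ,
        realify (U : Matrix (Fin 2) (Fin 2) ℂ) * Y *
          (realify (U : Matrix (Fin 2) (Fin 2) ℂ))ᵀ = Y) ↔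
      ∃ y : ℝ, Y = y • (1 : Matrix (Fin 2 × Fin 2) (Fin 2 × Fin 2) ℝ)) := by
  have key : ∀ Z : Matrix (Fin 2 × Fin 2) (Fin 2 × Fin 2) ℝ,
      Z = Z (0, 0) (0, 0) • (1 : Matrix (Fin 2 × Fin 2) (Fin 2 × Fin 2) ℝ)
        + Z (0, 0) (1, 0) • OmegaN 2 + Z (0, 0) (0, 1) • Xminus
        + (- Z (0, 0) (1, 1)) • (OmegaN 2 * Xminus) →
      Z ∈ Submodule.span ℝ ({1, OmegaN 2, Xminus, OmegaN 2 * Xminus} :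
          Set (Matrix (Fin 2 × Fin 2) (Fin 2 × Fin 2) ℝ)) := by
    intro Z hZ
    rw [hZ]
    refine add_mem (add_mem (add_mem ?_ ?_) ?_) ?_ <;>
      exact Submodule.smul_mem _ _ (Submodule.subset_span (by simp))
  refine ⟨⟨fun h => key X (comm_form X (h suI) (h suJ)), fun h U => ?_⟩, fun h => ?_, ?_⟩
  · induction h using Submodule.span_induction with
    | mem x hx =>
      rcases hx with rfl | rfl | rfl | rfl
      · simp
      · exact omega_comm _
      · exact xminus_comm U
      · rw [Matrix.mul_assoc, xminus_comm, ← Matrix.mul_assoc, omega_comm, Matrix.mul_assoc]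
    | zero => simp
    | add x y _ _ hx hy => rw [Matrix.add_mul, Matrix.mul_add, hx, hy]
    | smul a x _ hx => rw [Matrix.smul_mul, Matrix.mul_smul, hx]
  · have hc : ∀ U : Matrix.specialUnitaryGroup (Fin 2) ℂ,
        Y * realify U.1 = realify U.1 * Y := by
      intro U
      conv_lhs => rw [← h U]
      rw [Matrix.mul_assoc, realify_orth_left, Matrix.mul_one]
    have hf := comm_form Y (hc suI) (hc suJ)
    have hs := fun p q => hY.apply p q
    have hf' := fun p q => congrFun (congrFun hf p) q
    have z1 : Y (0, 0) (1, 0) = 0 := by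
      have a := hf' (1, 0) (0, 0)
      have b := hs (0, 0) (1, 0)
      simp [Matrix.mul_apply, Fintype.sum_prod_type, OmegaN, Omega1, Xminus, Zmat,
        Matrix.blockDiagonal_apply, Matrix.one_apply] at a
      linarith
    have z2 : Y (0, 0) (0, 1) = 0 := by
      have a := hf' (0, 1) (0, 0)
      have b := hs (0, 0) (0, 1)
      simp [Matrix.mul_apply, Fintype.sum_prod_type, OmegaN, Omega1, Xminus, Zmat,
        Matrix.blockDiagonal_apply, Matrix.one_apply] at a
      linarith
    have z3 : Y (0, 0) (1, 1) = 0 := by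
      have a := hf' (1, 1) (0, 0)
      have b := hs (0, 0) (1, 1)
      simp [Matrix.mul_apply, Fintype.sum_prod_type, OmegaN, Omega1, Xminus, Zmat,
        Matrix.blockDiagonal_apply, Matrix.one_apply] at a
      linarith
    refine ⟨Y (0, 0) (0, 0), ?_⟩
    rw [z1, z2, z3] at hf
    simpa using hf
  · rintro ⟨y, rfl⟩ U
    rw [Matrix.mul_smul, Matrix.smul_mul, Matrix.mul_one, realify_orth]
end
end
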